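/- For any sequence of edge probabilities p = p(n) with p(n)·log n → 0 as n → ∞, if G is a random DAG on n labeled vertices sampled from D(n,p), then the probability that the number of sources of G is at most 5/p tends to 1 as n → ∞. -/

import Mathlib

namespace CausalMEC

/-- A directed graph on `Fin n`, given by a Boolean edge function (`d a b = true` means `a → b`). -/
abbrev Dir (n : ℕ) := Fin n → Fin n → Bool

/-- Directed reachability (zero or more steps). -/
def Reach {n : ℕ} (d : Dir n) : Fin n → Fin n → Prop :=
  Relation.ReflTransGen fun a b => d a b = true

/-- No directed cycles (including no self-loops). -/
def Acyclic {n : ℕ} (d : Dir n) : Prop :=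
  ∀ v, ¬ Relation.TransGen (fun a b => d a b = true) v v

/-- A directed acyclic graph. -/
def IsDAG {n : ℕ} (d : Dir n) : Prop :=
  (∀ v, d v v = false) ∧ Acyclic d

/-- A directed (possibly cyclic) graph with edges between distinct vertices. -/
def IsDCG {n : ℕ} (d : Dir n) : Prop :=
  ∀ v, d v v = false

/-- The number of directed edges. -/
def edgeCount {n : ℕ} (d : Dir n) : ℕ :=
  (Finset.univ.filter fun q : Fin n × Fin n => d q.1 q.2 = true).card

/-- The parent set of a vertex. -/
def parents {n : ℕ} (d : Dir n) (v : Fin n) : Finset (Fin n) :=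
  Finset.univ.filter fun u => d u v = true

/-! ### Paths, d-connection and Markov equivalence in mixed graphs
A mixed graph is given by a directed part `d` and a bidirected part `b`. -/

/-- The kind of a step on a path: a directed edge traversed forwards, a directed edge
traversed backwards, or a bidirected edge. -/
inductive EdgeKind : Type
  | fwd | bwd | bidir
deriving DecidableEq

/-- Does the step point into its second endpoint? -/
def EdgeKind.intoSnd : EdgeKind → Bool
  | .fwd => true
  | .bwd => false
  | .bidir => true

/-- Does the step point into its first endpoint? -/
def EdgeKind.intoFst : EdgeKind → Bool
  | .fwd => false
  | .bwd => true
  | .bidir => true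

/-- A (possibly self-intersecting) path from `u` to `v` in the mixed graph `(d, b)`. -/
structure MPath {n : ℕ} (d b : Dir n) (u v : Fin n) where
  len : ℕ
  vert : Fin (len + 1) → Fin n
  kind : Fin len → EdgeKind
  first_eq : vert 0 = u
  last_eq : vert (Fin.last len) = v
  valid : ∀ i : Fin len,
    (kind i = .fwd → d (vert i.castSucc) (vert i.succ) = true) ∧
    (kind i = .bwd → d (vert i.succ) (vert i.castSucc) = true) ∧
    (kind i = .bidir → b (vert i.castSucc) (vert i.succ) = true)

/-- Whether the internal vertex at position `i` of a path is a collider. -/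
def MPath.colliderAt {n : ℕ} {d b : Dir n} {u v : Fin n} (π : MPath d b u v)
    (i : ℕ) (h1 : 0 < i) (h2 : i < π.len) : Bool :=
  (π.kind ⟨i - 1, by omega⟩).intoSnd && (π.kind ⟨i, h2⟩).intoFst

/-- A path is active given a conditioning set `Z` if every non-collider on it avoids `Z`
and every collider on it is in `Z` or has a descendant in `Z`. -/
def MPath.Active {n : ℕ} {d b : Dir n} {u v : Fin n} (π : MPath d b u v)
    (Z : Finset (Fin n)) : Prop :=
  ∀ (i : ℕ) (h1 : 0 < i) (h2 : i < π.len),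
    (π.colliderAt i h1 h2 = true →
      ∃ x ∈ Z, Reach d (π.vert ⟨i, by omega⟩) x) ∧
    (π.colliderAt i h1 h2 = false →
      π.vert ⟨i, by omega⟩ ∉ Z)

/-- d-connection given a conditioning set. -/
def DConn {n : ℕ} (d b : Dir n) (u v : Fin n) (Z : Finset (Fin n)) : Prop :=
  ∃ π : MPath d b u v, π.Active Z

/-- Markov equivalence of two mixed graphs: the same d-connection relations. -/
def MarkovEquiv {n : ℕ} (d b d' b' : Dir n) : Prop :=
  ∀ (u v : Fin n) (Z : Finset (Fin n)), u ≠ v → u ∉ Z → v ∉ Z →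
    (DConn d b u v Z ↔ DConn d' b' u v Z)

/-- The empty bidirected part: a purely directed graph. -/
def noBi (n : ℕ) : Dir n := fun _ _ => false

/-- Markov equivalence for purely directed graphs. -/
def MarkovEquivD {n : ℕ} (d d' : Dir n) : Prop :=
  MarkovEquiv d (noBi n) d' (noBi n)

/-- The Markov equivalence class of a DAG (within DAGs). -/
def MECdag {n : ℕ} (d : Dir n) : Set (Dir n) :=
  {d' | IsDAG d' ∧ MarkovEquivD d d'}

/-- An acyclic directed mixed graph. -/
def IsADMG {n : ℕ} (d b : Dir n) : Prop :=
  IsDAG d ∧ (∀ v w, b v w = b w v) ∧ (∀ v, b v v = false)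

/-- The Markov equivalence class of an ADMG (within ADMGs). -/
def MECadmg {n : ℕ} (d b : Dir n) : Set (Dir n × Dir n) :=
  {G | IsADMG G.1 G.2 ∧ MarkovEquiv d b G.1 G.2}

/-- The Markov equivalence class of a DCG (within DCGs). -/
def MECdcg {n : ℕ} (d : Dir n) : Set (Dir n) :=
  {d' | IsDCG d' ∧ MarkovEquivD d d'}

/-! ### The distribution `D(n,p)` and uniform ADMGs/DCGs -/

/-- The (unnormalized) weight of a DAG under `D(n,p)`. -/
noncomputable def dagWeight {n : ℕ} (p : ℝ) (d : Dir n) : ℝ :=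
  (p / (1 - p)) ^ edgeCount d

open scoped Classical in
/-- Probability of the event `A` under `D(n,p)`. -/
noncomputable def prD (n : ℕ) (p : ℝ) (A : Dir n → Prop) : ℝ :=
  (∑ d : Dir n, if IsDAG d ∧ A d then dagWeight p d else 0) /
    (∑ d : Dir n, if IsDAG d then dagWeight p d else 0)

open scoped Classical in
/-- Expectation of `f` under `D(n,p)`. -/
noncomputable def expD (n : ℕ) (p : ℝ) (f : Dir n → ℝ) : ℝ :=
  (∑ d : Dir n, if IsDAG d then f d * dagWeight p d else 0) /
    (∑ d : Dir n, if IsDAG d then dagWeight p d else 0)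

/-- Conditional probability of `A` given `B` under `D(n,p)`. -/
noncomputable def condPrD (n : ℕ) (p : ℝ) (A B : Dir n → Prop) : ℝ :=
  prD n p (fun d => A d ∧ B d) / prD n p B

open scoped Classical in
/-- Expectation of `f` under the uniform distribution on ADMGs on `n` vertices. -/
noncomputable def expADMG (n : ℕ) (f : Dir n × Dir n → ℝ) : ℝ :=
  (∑ G : Dir n × Dir n, if IsADMG G.1 G.2 then f G else 0) /
    (∑ G : Dir n × Dir n, if IsADMG G.1 G.2 then (1 : ℝ) else 0)

open scoped Classical in
/-- Expectation of `f` under the uniform distribution on DCGs on `n` vertices. -/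
noncomputable def expDCG (n : ℕ) (f : Dir n → ℝ) : ℝ :=
  (∑ d : Dir n, if IsDCG d then f d else 0) /
    (∑ d : Dir n, if IsDCG d then (1 : ℝ) else 0)

open scoped Classical in
/-- Probability of the event `A` under the uniform distribution on DCGs on `n` vertices. -/
noncomputable def prDCG (n : ℕ) (A : Dir n → Prop) : ℝ :=
  (∑ d : Dir n, if IsDCG d ∧ A d then (1 : ℝ) else 0) /
    (∑ d : Dir n, if IsDCG d then (1 : ℝ) else 0)

/-! ### Tower decomposition -/

/-- The sources of `d` within a vertex set `S` (no parents inside `S`). -/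
def sourcesIn {n : ℕ} (d : Dir n) (S : Finset (Fin n)) : Finset (Fin n) :=
  S.filter fun v => ∀ u ∈ S, d u v = false

/-- The vertices remaining after peeling off `k` layers of sources. -/
def remaining {n : ℕ} (d : Dir n) : ℕ → Finset (Fin n)
  | 0 => Finset.univ
  | k + 1 => remaining d k \ sourcesIn d (remaining d k)

/-- The `i`-th layer (1-based) of the tower decomposition of `d`. -/
def towerLayer {n : ℕ} (d : Dir n) (i : ℕ) : Finset (Fin n) :=
  sourcesIn d (remaining d (i - 1))

/-- The 1-based index of the layer containing `v`. -/
def layerIdx {n : ℕ} (d : Dir n) (v : Fin n) : ℕ :=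
  ((Finset.range n).filter fun j => v ∈ remaining d j).card

/-- The tower of a DAG: only the edges between adjacent layers are kept. -/
def tower {n : ℕ} (d : Dir n) : Dir n :=
  fun a c => d a c && decide (layerIdx d c = layerIdx d a + 1)

/-- `h` is the tower vector of `d` (layer sizes, 1-based, and no further layers). -/
def hasTowerVector {n : ℕ} (d : Dir n) (h : List ℕ) : Prop :=
  (∀ i : Fin h.length, (towerLayer d (i.val + 1)).card = h.get i) ∧
    towerLayer d (h.length + 1) = ∅

/-- `H` is the tower decomposition of `d`. -/
def hasTowerDecomp {n : ℕ} (d : Dir n) (H : List (Finset (Fin n))) : Prop :=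
  (∀ i : Fin H.length, towerLayer d (i.val + 1) = H.get i) ∧
    towerLayer d (H.length + 1) = ∅

/-- The weight `w(h)` of a tower vector `h = (h_1, …, h_s)`. -/
noncomputable def towerWeight (p : ℝ) (h : List ℕ) : ℝ :=
  (Nat.multinomial Finset.univ (fun i : Fin h.length => h.get i) : ℝ) *
    ∏ k ∈ Finset.Icc 2 h.length,
      (1 - (1 - p) ^ h.getD (k - 2) 0) ^ h.getD (k - 1) 0 /
        (1 - p) ^ (h.getD (k - 1) 0 * ∑ i ∈ Finset.range (k - 1), h.getD i 0)

/-! ### Edge reversal and deletion -/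

/-- Reverse the edge `v → w`. -/
def reverseEdge {n : ℕ} (d : Dir n) (v w : Fin n) : Dir n :=
  fun a c => if a = v ∧ c = w then false else if a = w ∧ c = v then true else d a c

/-- Delete the edge `v → w`. -/
def deleteEdge {n : ℕ} (d : Dir n) (v w : Fin n) : Dir n :=
  fun a c => if a = v ∧ c = w then false else d a c

/-- The edge `v → w` of a DAG is reversible: reversing it yields a Markov-equivalent DAG. -/
def Reversible {n : ℕ} (d : Dir n) (v w : Fin n) : Prop :=
  d v w = true ∧ IsDAG (reverseEdge d v w) ∧ MarkovEquivD d (reverseEdge d v w)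

/-- `d` has a matching of reversible layer-2-edges of size at least `m`. -/
def hasRevL2Matching {n : ℕ} (d : Dir n) (m : ℝ) : Prop :=
  ∃ S : Finset (Fin n × Fin n),
    (∀ e ∈ S, Reversible d e.1 e.2 ∧ e.2 ∈ towerLayer d 2) ∧
    (∀ e ∈ S, ∀ e' ∈ S, e ≠ e' →
      e.1 ≠ e'.1 ∧ e.1 ≠ e'.2 ∧ e.2 ≠ e'.1 ∧ e.2 ≠ e'.2) ∧
    m ≤ (S.card : ℝ)

/-! ### Cycles and the `Reverse` construction -/

/-- Cyclic successor in `Fin k`. -/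
def cycSucc {k : ℕ} (i : Fin k) : Fin k :=
  ⟨(i.val + 1) % k, Nat.mod_lt _ i.pos⟩

/-- The reversed parametrization of a cycle. -/
def cycRev {n k : ℕ} (c : Fin k → Fin n) : Fin k → Fin n :=
  fun i => c ⟨(k - i.val) % k, Nat.mod_lt _ i.pos⟩

/-- `c` lists the (distinct) vertices of a directed cycle of `d`, in order. -/
def IsCycle {n k : ℕ} (d : Dir n) (c : Fin k → Fin n) : Prop :=
  Function.Injective c ∧ ∀ i, d (c i) (c (cycSucc i)) = true

/-- The `Reverse(G, C)` construction: reverse the cycle `c` and redirect every edge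
`w → v_i` with `w ∈ Pa(v_i) \ {v_{i-1}}` to `w → v_{i-1}`. -/
def reverseCycle {n k : ℕ} (d : Dir n) (c : Fin k → Fin n) : Dir n :=
  fun a e =>
    decide ((∃ j : Fin k, e = c j ∧
        (a = c (cycSucc j) ∨ (d a (c (cycSucc j)) = true ∧ a ≠ c j))) ∨
      ((∀ j : Fin k, e ≠ c j) ∧ d a e = true))

/-- A vertex triple induces exactly a directed 3-cycle. -/
def induces3Cycle {n : ℕ} (d : Dir n) (W : Finset (Fin n)) : Prop :=
  ∃ a b c : Fin n, W = {a, b, c} ∧ a ≠ b ∧ a ≠ c ∧ b ≠ c ∧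
    d a b = true ∧ d b c = true ∧ d c a = true ∧
    d b a = false ∧ d c b = false ∧ d a c = false

/-! ### Adding a source to a directed graph -/

/-- The directed graph obtained from `g` by inserting a new source at position `v`, whose
children are the vertices selected by `O`. -/
def insertSource {n : ℕ} (v : Fin (n + 1)) (O : Fin n → Bool) (g : Dir n) : Dir (n + 1) :=
  v.insertNth (α := fun _ => Fin (n + 1) → Bool)
    (v.insertNth (α := fun _ => Bool) false O)
    (fun i => v.insertNth (α := fun _ => Bool) false (g i))

section insertSource

variable {n : ℕ} (v : Fin (n + 1)) (O : Fin n → Bool) (g : Dir n)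

@[simp] lemma insertSource_new_new : insertSource v O g v v = false := by
  simp [insertSource]

@[simp] lemma insertSource_new_old (j : Fin n) :
    insertSource v O g v (v.succAbove j) = O j := by
  simp [insertSource]

@[simp] lemma insertSource_old_new (i : Fin n) :
    insertSource v O g (v.succAbove i) v = false := by
  simp [insertSource]

@[simp] lemma insertSource_old_old (i j : Fin n) :
    insertSource v O g (v.succAbove i) (v.succAbove j) = g i j := by
  simp [insertSource]

lemma insertSource_into_new (a : Fin (n + 1)) : insertSource v O g a v = false := by
  rcases Fin.eq_self_or_eq_succAbove v a with rfl | ⟨i, rfl⟩ <;> simp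

lemma transGen_insertSource {x y : Fin (n + 1)}
    (h : Relation.TransGen (fun a b => insertSource v O g a b = true) x y) :
    y ≠ v ∧ ∀ i, x = v.succAbove i →
      ∃ j, y = v.succAbove j ∧ Relation.TransGen (fun a b => g a b = true) i j := by
  have key : ∀ b c, insertSource v O g b c = true → ∃ l, c = v.succAbove l := by
    intro b c hbc
    rcases Fin.eq_self_or_eq_succAbove v c with rfl | h
    · simp [insertSource_into_new] at hbc
    · exact h
  induction h with
  | single hxy =>
    obtain ⟨l, rfl⟩ := key _ _ hxy
    refine ⟨Fin.succAbove_ne v l, ?_⟩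
    rintro i rfl
    exact ⟨l, rfl, .single (by simpa using hxy)⟩
  | tail _ hbc ih =>
    obtain ⟨l, rfl⟩ := key _ _ hbc
    refine ⟨Fin.succAbove_ne v l, fun i hi => ?_⟩
    obtain ⟨j, rfl, hj⟩ := ih.2 i hi
    exact ⟨l, rfl, hj.tail (by simpa using hbc)⟩

lemma isDAG_insertSource : IsDAG (insertSource v O g) ↔ IsDAG g := by
  constructor
  · rintro ⟨h1, h2⟩
    refine ⟨fun i => by simpa using h1 (v.succAbove i), fun i hi => h2 (v.succAbove i) ?_⟩
    exact Relation.TransGen.lift v.succAbove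
      (fun a b hab => by simpa [Function.onFun] using hab) _ _ hi
  · rintro ⟨h1, h2⟩
    refine ⟨fun x => ?_, fun x hx => ?_⟩
    · rcases Fin.eq_self_or_eq_succAbove v x with rfl | ⟨i, rfl⟩
      · simp
      · simpa using h1 i
    · obtain ⟨hne, h⟩ := transGen_insertSource v O g hx
      rcases Fin.eq_self_or_eq_succAbove v x with rfl | ⟨i, rfl⟩
      · exact hne rfl
      · obtain ⟨j, hj, hij⟩ := h i rfl
        rw [← Fin.succAbove_right_injective hj] at hij
        exact h2 i hij

lemma edgeCount_eq_sum {m : ℕ} (d : Dir m) :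
    edgeCount d = ∑ a, ∑ b, if d a b = true then 1 else 0 := by
  rw [edgeCount, Finset.card_filter, Fintype.sum_prod_type]

lemma edgeCount_insertSource :
    edgeCount (insertSource v O g) = (∑ i, if O i = true then 1 else 0) + edgeCount g := by
  simp [edgeCount_eq_sum, Fin.sum_univ_succAbove _ v]

lemma card_sourcesIn_eq_sum {m : ℕ} (d : Dir m) :
    (sourcesIn d Finset.univ).card = ∑ b, if ∀ a, d a b = false then 1 else 0 := by
  simp [sourcesIn]

lemma card_sourcesIn_insertSource :
    (sourcesIn (insertSource v O g) Finset.univ).card =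
      ((sourcesIn g Finset.univ).filter fun i => O i = false).card + 1 := by
  rw [card_sourcesIn_eq_sum, Fin.sum_univ_succAbove _ v]
  simp only [insertSource_into_new, Fin.forall_iff_succAbove v, insertSource_new_old,
    insertSource_old_old, implies_true, if_true]
  rw [add_comm, ← Finset.card_filter]
  congr 2
  ext i
  simp [sourcesIn, and_comm]

end insertSource

open scoped Classical in
/-- Summing over the DAGs having `v` as a source amounts to summing over the DAGs on the
remaining vertices and the sets of children of `v`. -/
lemma sum_isDAG_source {n : ℕ} (v : Fin (n + 1)) (F : Dir (n + 1) → ℝ) :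
    (∑ d : Dir (n + 1), if IsDAG d ∧ (∀ a, d a v = false) then F d else 0) =
      ∑ g : Dir n, if IsDAG g then ∑ O : Fin n → Bool, F (insertSource v O g) else 0 := by
  have h : ∀ g : Dir n, (if IsDAG g then ∑ O : Fin n → Bool, F (insertSource v O g) else 0) =
      ∑ O : Fin n → Bool, if IsDAG g then F (insertSource v O g) else 0 := by
    intro g; split_ifs <;> simp
  simp only [h]
  rw [← Fintype.sum_prod_type'
      (f := fun (g : Dir n) O => if IsDAG g then F (insertSource v O g) else 0),
    ← Finset.sum_filter, ← Finset.sum_filter (s := (Finset.univ : Finset (Dir n × (Fin n → Bool))))]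
  symm
  refine Finset.sum_nbij' (fun x => insertSource v x.2 x.1)
    (fun d => (fun i j => d (v.succAbove i) (v.succAbove j), fun j => d v (v.succAbove j)))
    ?_ ?_ ?_ ?_ ?_
  · rintro ⟨g, O⟩ hg
    simpa [isDAG_insertSource, insertSource_into_new] using hg
  · intro d hd
    simp only [Finset.mem_filter, Finset.mem_univ, true_and] at hd ⊢
    refine ⟨fun i => hd.1.1 _, fun i hi => hd.1.2 (v.succAbove i) ?_⟩
    exact Relation.TransGen.lift v.succAbove (fun a b hab => hab) _ _ hi
  · rintro ⟨g, O⟩ _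
    simp
  · intro d hd
    simp only [Finset.mem_filter, Finset.mem_univ, true_and] at hd
    funext a b
    rcases Fin.eq_self_or_eq_succAbove v b with rfl | ⟨j, rfl⟩
    · rw [insertSource_into_new, hd.2]
    · rcases Fin.eq_self_or_eq_succAbove v a with rfl | ⟨i, rfl⟩ <;> simp
  · intros; rfl

/-! ### Sums over the children of the new source -/

lemma sum_pow_card {n : ℕ} (r : ℝ) :
    ∑ O : Fin n → Bool, r ^ (∑ i, if O i = true then 1 else 0) = (1 + r) ^ n := by
  have h := Fintype.prod_sum (fun (_ : Fin n) (b : Bool) => r ^ (if b = true then 1 else 0))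
  simp only [Finset.prod_pow_eq_pow_sum] at h
  rw [← h]
  simp [add_comm]

lemma sum_pow_card_of_eq_false {n : ℕ} (r : ℝ) (j : Fin n) :
    (1 + r) * ∑ O : Fin n → Bool,
      (if O j = false then r ^ (∑ i, if O i = true then 1 else 0) else 0) = (1 + r) ^ n := by
  have h := Fintype.prod_sum (fun (i : Fin n) (b : Bool) =>
    (if i = j ∧ b = true then 0 else 1) * r ^ (if b = true then 1 else 0))
  simp only [Finset.prod_mul_distrib, Finset.prod_pow_eq_pow_sum] at h
  have h2 : ∀ O : Fin n → Bool,
      (∏ i, if i = j ∧ O i = true then (0 : ℝ) else 1) = if O j = false then 1 else 0 := by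
    intro O
    rw [Finset.prod_eq_single j (by intro b _ hb; simp [hb]) (by simp)]
    cases O j <;> simp
  simp only [h2, ite_mul, one_mul, zero_mul] at h
  rw [← h, ← Finset.mul_prod_erase _ _ (Finset.mem_univ j)]
  rw [Finset.prod_congr rfl (g := fun _ => 1 + r) (by
    intro i hi
    simp [Finset.ne_of_mem_erase hi, add_comm])]
  have hn : n - 1 + 1 = n := Nat.sub_add_cancel j.pos
  simp [← pow_succ', hn]

lemma sum_pow_card_mul_card {n : ℕ} (r : ℝ) (S : Finset (Fin n)) :
    (1 + r) * ∑ O : Fin n → Bool, r ^ (∑ i, if O i = true then 1 else 0) *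
      ((S.filter fun i => O i = false).card : ℝ) = (1 + r) ^ n * S.card := by
  have h : ∀ O : Fin n → Bool, r ^ (∑ i, if O i = true then 1 else 0) *
      ((S.filter fun i => O i = false).card : ℝ) =
      ∑ j ∈ S, if O j = false then r ^ (∑ i, if O i = true then 1 else 0) else 0 := by
    intro O
    rw [← Finset.sum_filter (s := S), Finset.sum_const, nsmul_eq_mul, mul_comm]
  simp only [h]
  rw [Finset.sum_comm, Finset.mul_sum, Finset.sum_congr rfl fun j _ => sum_pow_card_of_eq_false r j,
    Finset.sum_const, nsmul_eq_mul, mul_comm]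

/-! ### Factorial moments of the number of sources -/

open scoped Classical in
/-- The unnormalized `k`-th factorial moment of the number of sources under `D(n,p)`. -/
noncomputable def sourceMoment (p : ℝ) (n k : ℕ) : ℝ :=
  ∑ d : Dir n, if IsDAG d then
    dagWeight p d * ((sourcesIn d Finset.univ).card.descFactorial k : ℝ) else 0

section moments

variable {p : ℝ}

lemma dagWeight_nonneg (hp : 0 < p) (hp1 : p < 1) {n : ℕ} (d : Dir n) : 0 ≤ dagWeight p d :=
  pow_nonneg (div_nonneg hp.le (by linarith)) _

lemma sourceMoment_nonneg (hp : 0 < p) (hp1 : p < 1) (n k : ℕ) : 0 ≤ sourceMoment p n k := by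
  refine Finset.sum_nonneg fun d _ => ?_
  split_ifs
  · exact mul_nonneg (dagWeight_nonneg hp hp1 d) (Nat.cast_nonneg _)
  · rfl

lemma isDAG_noBi (n : ℕ) : IsDAG (noBi n) := by
  refine ⟨fun _ => rfl, fun v hv => ?_⟩
  obtain ⟨_, _, h⟩ := Relation.TransGen.tail'_iff.mp hv
  simp [noBi] at h

lemma sourceMoment_zero_pos (hp : 0 < p) (hp1 : p < 1) (n : ℕ) : 0 < sourceMoment p n 0 := by
  refine Finset.sum_pos' (fun d _ => ?_) ⟨noBi n, Finset.mem_univ _, ?_⟩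
  · split_ifs
    · simpa using dagWeight_nonneg hp hp1 d
    · rfl
  · rw [if_pos (isDAG_noBi n)]
    simpa [dagWeight] using pow_pos (div_pos hp (sub_pos.mpr hp1)) _

lemma sourceMoment_zero_succ (k : ℕ) : sourceMoment p 0 (k + 1) = 0 := by
  simp [sourceMoment, sourcesIn]

open scoped Classical in
/-- Recursion for the factorial moments, obtained by singling out one source. -/
lemma sourceMoment_succ_succ (n k : ℕ) :
    sourceMoment p (n + 1) (k + 1) = (n + 1) * ∑ g : Dir n, if IsDAG g then dagWeight p g *
      ∑ O : Fin n → Bool, (p / (1 - p)) ^ (∑ i, if O i = true then 1 else 0) *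
        ((((sourcesIn g Finset.univ).filter fun i => O i = false).card.descFactorial k : ℕ) : ℝ)
      else 0 := by
  have h : ∀ d : Dir (n + 1), (if IsDAG d then
      dagWeight p d * ((sourcesIn d Finset.univ).card.descFactorial (k + 1) : ℝ) else 0) =
      ∑ v, if IsDAG d ∧ (∀ a, d a v = false) then dagWeight p d *
        (((sourcesIn d Finset.univ).card - 1).descFactorial k : ℝ) else 0 := by
    intro d
    by_cases hd : IsDAG d
    · simp only [hd, true_and, if_true]
      rw [← Finset.sum_filter, Finset.sum_const, nsmul_eq_mul]
      have hs : (Finset.univ.filter fun v => ∀ a, d a v = false) = sourcesIn d Finset.univ := by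
        ext; simp [sourcesIn]
      rw [hs]
      rcases Nat.eq_zero_or_pos (sourcesIn d Finset.univ).card with h0 | h0
      · simp [h0]
      · obtain ⟨m, hm⟩ := Nat.exists_eq_succ_of_ne_zero h0.ne'
        rw [hm, Nat.succ_descFactorial_succ]
        simp only [Nat.succ_eq_add_one, Nat.add_sub_cancel]
        push_cast
        ring
    · simp [hd]
  rw [sourceMoment, Finset.sum_congr rfl fun d _ => h d, Finset.sum_comm]
  simp only [sum_isDAG_source, card_sourcesIn_insertSource, Nat.add_sub_cancel, dagWeight,
    edgeCount_insertSource, pow_add, Finset.sum_const, Finset.card_univ, Fintype.card_fin,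
    nsmul_eq_mul, Nat.cast_add, Nat.cast_one]
  congr! 3
  rw [Finset.mul_sum]
  refine Finset.sum_congr rfl fun O _ => ?_
  ring

lemma sourceMoment_succ_one (n : ℕ) : sourceMoment p (n + 1) 1 =
    (n + 1) * (1 + p / (1 - p)) ^ n * sourceMoment p n 0 := by
  rw [sourceMoment_succ_succ, mul_assoc, sourceMoment, Finset.mul_sum _ _ ((1 + p / (1 - p)) ^ n)]
  simp only [Nat.descFactorial_zero, Nat.cast_one, mul_one, sum_pow_card, ite_mul, zero_mul,
    mul_comm ((1 + p / (1 - p)) ^ n)]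

lemma sourceMoment_succ_two (hp1 : p < 1) (n : ℕ) : sourceMoment p (n + 1) 2 =
    (n + 1) * (1 + p / (1 - p)) ^ n * ((1 - p) * sourceMoment p n 1) := by
  have hq : (1 - p) ≠ 0 := by linarith
  have h1 : (1 + p / (1 - p)) = (1 - p)⁻¹ := by field_simp; ring
  have h (S : Finset (Fin n)) := sum_pow_card_mul_card (p / (1 - p)) S
  nth_rewrite 1 [h1] at h
  simp only [inv_mul_eq_iff_eq_mul₀ hq] at h
  rw [sourceMoment_succ_succ, mul_assoc, sourceMoment, Finset.mul_sum _ _ (1 - p),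
    Finset.mul_sum _ _ ((1 + p / (1 - p)) ^ n)]
  simp only [Nat.descFactorial_one, h]
  congr! 2
  split_ifs <;> ring

lemma sourceMoment_succ_succ_le (hp : 0 < p) (hp1 : p < 1) (n k : ℕ) :
    sourceMoment p (n + 1) (k + 1) ≤
      (n + 1) * (1 + p / (1 - p)) ^ n * sourceMoment p n k := by
  rw [sourceMoment_succ_succ, mul_assoc, sourceMoment, Finset.mul_sum _ _ ((1 + p / (1 - p)) ^ n)]
  refine mul_le_mul_of_nonneg_left (Finset.sum_le_sum fun g _ => ?_) (by positivity)
  split_ifs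
  · rw [mul_left_comm, ← sum_pow_card, Finset.sum_mul]
    refine mul_le_mul_of_nonneg_left (Finset.sum_le_sum fun O _ => ?_) (dagWeight_nonneg hp hp1 g)
    refine mul_le_mul_of_nonneg_left ?_ (pow_nonneg (div_nonneg hp.le (by linarith)) _)
    exact_mod_cast Nat.descFactorial_le k (Finset.card_filter_le _ _)
  · simp

/-- The Cauchy–Schwarz inequality for the number of sources. -/
lemma sourceMoment_one_sq_le (hp : 0 < p) (hp1 : p < 1) (n : ℕ) : sourceMoment p n 1 ^ 2 ≤
    sourceMoment p n 0 * (sourceMoment p n 2 + sourceMoment p n 1) := by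
  classical
  rw [sourceMoment, sourceMoment, sourceMoment, ← Finset.sum_add_distrib]
  refine Finset.sum_sq_le_sum_mul_sum_of_sq_le_mul _ (fun d _ => ?_) (fun d _ => ?_)
    fun d _ => le_of_eq ?_
  all_goals
    have hw := dagWeight_nonneg hp hp1 d
    split_ifs
    · first
      | positivity
      | rcases Nat.eq_zero_or_pos (sourcesIn d Finset.univ).card with h0 | h0
        · simp [h0]
        · simp only [Nat.descFactorial_succ, Nat.descFactorial_zero, Nat.sub_zero, mul_one]
          push_cast [Nat.cast_sub h0]
          ring
    · simp

/-- The expected number of sources is at most `1 / p`. -/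
lemma mul_sourceMoment_one_le (hp : 0 < p) (hp1 : p < 1) (n : ℕ) :
    p * sourceMoment p n 1 ≤ sourceMoment p n 0 := by
  induction n with
  | zero => simpa [sourceMoment_zero_succ] using (sourceMoment_zero_pos hp hp1 0).le
  | succ n ih =>
    have hM := sourceMoment_succ_one (p := p) n
    have hsq := sourceMoment_one_sq_le hp hp1 (n + 1)
    rw [sourceMoment_succ_two hp1] at hsq
    have hc : 0 < (n + 1) * (1 + p / (1 - p)) ^ n :=
      mul_pos (by positivity)
        (pow_pos (add_pos one_pos (div_pos hp (sub_pos.mpr hp1))) _)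
    have hZ := sourceMoment_zero_pos hp hp1 (n + 1)
    have hM1 : 0 < sourceMoment p (n + 1) 1 := hM ▸ mul_pos hc (sourceMoment_zero_pos hp hp1 n)
    have h1 : p * ((n + 1) * (1 + p / (1 - p)) ^ n * ((1 - p) * sourceMoment p n 1)) ≤
        (1 - p) * sourceMoment p (n + 1) 1 := by
      rw [hM]
      nlinarith [mul_le_mul_of_nonneg_left ih (mul_pos hc (sub_pos.mpr hp1)).le]
    refine le_of_mul_le_mul_right ?_ hM1
    nlinarith [mul_le_mul_of_nonneg_left hsq hp.le, mul_le_mul_of_nonneg_left h1 hZ.le]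

lemma pow_mul_sourceMoment_le (hp : 0 < p) (hp1 : p < 1) (n k : ℕ) :
    p ^ k * sourceMoment p n k ≤ sourceMoment p n 0 := by
  induction k generalizing n with
  | zero => simp
  | succ k ih =>
    cases n with
    | zero => simpa [sourceMoment_zero_succ] using (sourceMoment_zero_pos hp hp1 0).le
    | succ n =>
      have hc : 0 ≤ (n + 1) * (1 + p / (1 - p)) ^ n :=
        mul_nonneg (by positivity)
          (pow_nonneg (add_nonneg zero_le_one (div_nonneg hp.le (by linarith))) _)
      calc p ^ (k + 1) * sourceMoment p (n + 1) (k + 1)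
          ≤ p ^ (k + 1) * ((n + 1) * (1 + p / (1 - p)) ^ n * sourceMoment p n k) :=
            mul_le_mul_of_nonneg_left (sourceMoment_succ_succ_le hp hp1 n k) (by positivity)
        _ = p * ((n + 1) * (1 + p / (1 - p)) ^ n * (p ^ k * sourceMoment p n k)) := by ring
        _ ≤ p * ((n + 1) * (1 + p / (1 - p)) ^ n * sourceMoment p n 0) :=
            mul_le_mul_of_nonneg_left (mul_le_mul_of_nonneg_left (ih n) hc) hp.le
        _ = p * sourceMoment p (n + 1) 1 := by rw [sourceMoment_succ_one]
        _ ≤ sourceMoment p (n + 1) 0 := mul_sourceMoment_one_le hp hp1 _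

end moments

/-! ### Tail bound -/

lemma prD_le_one {p : ℝ} (hp : 0 < p) (hp1 : p < 1) (n : ℕ) (A : Dir n → Prop) :
    prD n p A ≤ 1 := by
  have hw := fun d : Dir n => dagWeight_nonneg hp hp1 d
  refine div_le_one_of_le₀ (Finset.sum_le_sum fun d _ => ?_) (Finset.sum_nonneg fun d _ => ?_)
  · by_cases h : IsDAG d <;> by_cases h' : A d <;> simp [h, h', hw]
  · split_ifs <;> simp [hw]

/-- A bound on the probability of having fewer than `k` sources, by Markov's inequality for the
`k`-th factorial moment. -/
lemma one_sub_le_prD {p : ℝ} (hp : 0 < p) (hp1 : p < 1) (n k : ℕ) (A : Dir n → Prop)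
    (hA : ∀ d, ¬ A d → k ≤ (sourcesIn d Finset.univ).card) :
    1 - (1 / p) ^ k / (k.factorial : ℝ) ≤ prD n p A := by
  classical
  have hZ := sourceMoment_zero_pos hp hp1 n
  have hf : (0 : ℝ) < k.factorial := by exact_mod_cast k.factorial_pos
  have hZe : (∑ d : Dir n, if IsDAG d then dagWeight p d else 0) = sourceMoment p n 0 := by
    simp [sourceMoment]
  have hk : sourceMoment p n 0 - sourceMoment p n k / k.factorial ≤
      ∑ d : Dir n, if IsDAG d ∧ A d then dagWeight p d else 0 := by
    rw [sourceMoment, sourceMoment, Finset.sum_div, ← Finset.sum_sub_distrib]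
    refine Finset.sum_le_sum fun d _ => ?_
    have hw := dagWeight_nonneg hp hp1 d
    by_cases h : IsDAG d
    · by_cases h' : A d
      · simp only [h, h', and_self, if_true, Nat.descFactorial_zero, Nat.cast_one, mul_one]
        have : 0 ≤ dagWeight p d *
            ((sourcesIn d Finset.univ).card.descFactorial k : ℝ) / k.factorial := by positivity
        linarith
      · simp only [h, h', and_false, if_true, if_false, Nat.descFactorial_zero, Nat.cast_one,
          mul_one, sub_nonpos]
        rw [le_div_iff₀ hf]
        refine mul_le_mul_of_nonneg_left ?_ hw
        have := Nat.descFactorial_le k (hA d h')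
        rw [Nat.descFactorial_self] at this
        exact_mod_cast this
    · simp [h]
  have hkm := pow_mul_sourceMoment_le hp hp1 n k
  unfold prD
  refine le_trans ?_ (div_le_div_of_nonneg_right (by convert hk) ?_)
  · rw [hZe, sub_div, div_self hZ.ne']
    refine sub_le_sub_left ?_ _
    rw [div_div, mul_comm, ← div_div]
    refine div_le_div_of_nonneg_right ?_ hf.le
    rw [div_le_iff₀ hZ, one_div, inv_pow, inv_mul_eq_div, le_div_iff₀ (by positivity), mul_comm]
    exact hkm
  · exact hZe ▸ hZ.le

lemma inv_pow_div_factorial_le {p : ℝ} (hp : 0 < p) {k : ℕ} (hk : 5 / p ≤ k) :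
    (1 / p) ^ k / (k.factorial : ℝ) ≤ (Real.exp 1 / 5) ^ k := by
  have h := Real.pow_div_factorial_le_exp (5 / p) (by positivity) k
  have h2 : Real.exp (5 / p) ≤ Real.exp 1 ^ k := by
    rw [← Real.exp_nat_mul, mul_one]; exact Real.exp_le_exp.mpr hk
  rw [div_pow (Real.exp 1), le_div_iff₀ (by positivity)]
  calc (1 / p) ^ k / (k.factorial : ℝ) * 5 ^ k = (5 / p) ^ k / k.factorial := by
        rw [div_pow, div_pow]; ring
    _ ≤ _ := h.trans h2

/-- Lemma 3.3: for `0 < p n < 1` with `p n · log n → 0`, the number of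
sources of a random DAG `G ~ D(n, p n)` is at most `5 / p n` with high probability. -/
theorem source_count_upper_bound (p : ℕ → ℝ)
    (hpos : ∀ n : ℕ, 0 < p n) (hub : ∀ n : ℕ, p n < 1)
    (hto : Filter.Tendsto (fun n : ℕ => p n * Real.log n) Filter.atTop (nhds 0)) :
    Filter.Tendsto
      (fun n : ℕ => prD n (p n) fun d =>
        ((sourcesIn d Finset.univ).card : ℝ) ≤ 5 / p n)
      Filter.atTop (nhds 1) := by
  have hp0 : Filter.Tendsto p Filter.atTop (nhds 0) := by
    refine squeeze_zero' (.of_forall fun n => (hpos n).le) ?_ hto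
    filter_upwards [Filter.eventually_ge_atTop 3] with n hn
    have h1 : 1 ≤ Real.log n := by
      rw [Real.le_log_iff_exp_le (by positivity)]
      have : (3 : ℝ) ≤ n := by exact_mod_cast hn
      linarith [Real.exp_one_lt_d9]
    nlinarith [hpos n]
  have hinv : Filter.Tendsto (fun n => 5 / p n) Filter.atTop Filter.atTop := by
    have : Filter.Tendsto p Filter.atTop (nhdsWithin 0 (Set.Ioi 0)) :=
      tendsto_nhdsWithin_iff.mpr ⟨hp0, .of_forall hpos⟩
    simpa [div_eq_mul_inv] using
      (this.inv_tendsto_nhdsGT_zero).const_mul_atTop (show (0 : ℝ) < 5 by norm_num)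
  have hk : Filter.Tendsto (fun n => ⌊5 / p n⌋₊ + 1) Filter.atTop Filter.atTop :=
    (Filter.tendsto_add_atTop_nat 1).comp (tendsto_nat_floor_atTop.comp hinv)
  have hlim : Filter.Tendsto (fun n => 1 - (Real.exp 1 / 5) ^ (⌊5 / p n⌋₊ + 1))
      Filter.atTop (nhds 1) := by
    have := (tendsto_pow_atTop_nhds_zero_of_lt_one (r := Real.exp 1 / 5) (by positivity)
      (by linarith [Real.exp_one_lt_d9])).comp hk
    simpa using this.const_sub 1
  refine tendsto_of_tendsto_of_tendsto_of_le_of_le hlim tendsto_const_nhds (fun n => ?_)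
    fun n => prD_le_one (hpos n) (hub n) _ _
  refine le_trans ?_ (one_sub_le_prD (hpos n) (hub n) n (⌊5 / p n⌋₊ + 1) _ fun d hd => ?_)
  · refine sub_le_sub_left (inv_pow_div_factorial_le (hpos n) ?_) _
    exact_mod_cast (Nat.lt_floor_add_one (5 / p n)).le
  · exact (Nat.floor_lt (div_pos (by norm_num) (hpos n)).le).mpr (not_le.mp hd)

end CausalMEC
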